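/- arXiv:2307.10109 — 3 statements merged into one kernel-verified Lean document; each statement's English description precedes it below -/
import Mathlib

section
/- Let K = ∏_{j=1}^n K_j be as in the rational self-similar fractal setup with γ_j = log(#Λ_j)/log r. Suppose τ = (τ_1,…,τ_n) ∈ ℝ^n_{>0} satisfies Σ_{i=1}^n τ_i γ_i = 1. Then there exists a constant C > 0 such that for every x = (x_1,…,x_n) ∈ K and every real Q > r there exists a rational point p/q = (p_1/q,…,p_n/q) ∈ ℚ^n ∩ K with q ∈ ℕ, q ≤ Q, and |x_i − p_i/q| < C/(q·(log Q)^{τ_i}) for all 1 ≤ i ≤ n. -/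
/-- Every point of a self-similar set has a coding: a digit sequence together with its orbit
under the inverse branches. -/
lemma exists_digits_orbit {r : ℕ} {D : Finset ℕ} {K : Set ℝ}
    (hK : K = ⋃ a ∈ D, (fun x : ℝ => (x + a) / r) '' K) {x : ℝ} (hx : x ∈ K) :
    ∃ (a : ℕ → ℕ) (z : ℕ → ℝ), z 0 = x ∧ (∀ k, a k ∈ D) ∧ (∀ k, z k ∈ K) ∧
      ∀ k, z k = (z (k + 1) + a k) / r := by
  have step : ∀ y : K, ∃ (b : ℕ) (w : K), b ∈ D ∧ (y : ℝ) = ((w : ℝ) + b) / r := by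
    rintro ⟨y, hy⟩
    rw [hK] at hy
    simp only [Set.mem_iUnion, Set.mem_image] at hy
    obtain ⟨b, hb, w, hw, rfl⟩ := hy
    exact ⟨b, ⟨w, hw⟩, hb, rfl⟩
  choose digit next hdigit hnext using step
  refine ⟨fun k => digit (next^[k] ⟨x, hx⟩), fun k => next^[k] ⟨x, hx⟩, rfl,
    fun k => hdigit _, fun k => Subtype.coe_prop _, fun k => ?_⟩
  simp only [Function.iterate_succ_apply']
  exact hnext _

/-- A block of consecutive digits acts as an affine contraction with integer translation part
which preserves the self-similar set. -/
lemma exists_block_map {r : ℕ} (hr : 0 < r) {K : Set ℝ} {a : ℕ → ℕ} {z : ℕ → ℝ}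
    (hmap : ∀ k, ∀ u ∈ K, (u + a k) / r ∈ K) (hz : ∀ k, z k = (z (k + 1) + a k) / r)
    (s l : ℕ) :
    ∃ B : ℕ, (∀ u ∈ K, (u + B) / (r : ℝ) ^ l ∈ K) ∧ z s = (z (s + l) + B) / (r : ℝ) ^ l := by
  have hr' : (r : ℝ) ≠ 0 := by positivity
  induction l with
  | zero => exact ⟨0, by simp, by simp⟩
  | succ l ih =>
    obtain ⟨B, hB, hzB⟩ := ih
    have key : ∀ u : ℝ, (u + ((a (s + l) + B * r : ℕ) : ℝ)) / (r : ℝ) ^ (l + 1)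
        = ((u + a (s + l)) / r + B) / (r : ℝ) ^ l := by
      intro u
      push_cast
      field_simp
      ring
    refine ⟨a (s + l) + B * r, fun u hu => ?_, ?_⟩
    · rw [key]
      exact hB _ (hmap _ u hu)
    · rw [key, hzB, hz (s + l), add_assoc]

/-- Points of the orbit whose codings share a word of length `L` are `r⁻ᴸ`-close. -/
lemma abs_sub_le_of_digits_eq {r : ℕ} (hr : 0 < r) {a : ℕ → ℕ} {z : ℕ → ℝ}
    (h01 : ∀ k, z k ∈ Set.Icc (0 : ℝ) 1) (hz : ∀ k, z k = (z (k + 1) + a k) / r)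
    (L s t : ℕ) (h : ∀ k < L, a (s + k) = a (t + k)) :
    |z t - z s| ≤ 1 / (r : ℝ) ^ L := by
  have hr' : (0 : ℝ) < r := by positivity
  induction L generalizing s t with
  | zero =>
    have hs := h01 s
    have ht := h01 t
    simp only [Set.mem_Icc] at hs ht
    rw [abs_le]
    constructor <;> norm_num <;> linarith
  | succ L ih =>
    have h0 : a s = a t := by simpa using h 0 (Nat.succ_pos L)
    have h1 : |z (t + 1) - z (s + 1)| ≤ 1 / (r : ℝ) ^ L := by
      refine ih (s + 1) (t + 1) fun k hk => ?_
      have := h (k + 1) (by omega)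
      simpa [add_assoc, add_comm, add_left_comm] using this
    have h2 : z t - z s = (z (t + 1) - z (s + 1)) / r := by
      rw [hz t, hz s, h0]
      ring
    rw [h2, abs_div, abs_of_pos hr', pow_succ, ← div_div]
    gcongr

/-- A nonempty compact set preserved by `u ↦ (u + A) / R`, `R > 1`, contains its fixed point. -/
lemma fixedPoint_mem {K : Set ℝ} (hK : IsCompact K) (hne : K.Nonempty) {A R : ℝ} (hR : 1 < R)
    (hmap : ∀ u ∈ K, (u + A) / R ∈ K) : A / (R - 1) ∈ K := by
  obtain ⟨w, hw, hmin⟩ := hK.exists_isMinOn hne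
    (f := fun u => |u - A / (R - 1)|) (by fun_prop)
  have h1 : |w - A / (R - 1)| ≤ |(w + A) / R - A / (R - 1)| := hmin (hmap w hw)
  have hR1 : R - 1 ≠ 0 := by linarith
  have hR0 : 0 < R := by linarith
  have h2 : (w + A) / R - A / (R - 1) = (w - A / (R - 1)) / R := by
    field_simp
    ring
  rw [h2, abs_div, abs_of_pos hR0, le_div_iff₀ hR0] at h1
  have h3 : |w - A / (R - 1)| = 0 := by
    nlinarith [abs_nonneg (w - A / (R - 1))]
  rw [abs_eq_zero, sub_eq_zero] at h3
  rwa [← h3]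

/-- If the codings of `x` at positions `s < t` share a word of length `L`, then the point whose
coding is eventually periodic with period `t - s` from position `s` on is a rational point with
denominator `rˢ (rᵗ⁻ˢ - 1)` approximating `x`. -/
lemma exists_rational_approx {r : ℕ} (hr : 2 ≤ r) {K : Set ℝ} (hK : IsCompact K)
    (h01K : K ⊆ Set.Icc 0 1) {a : ℕ → ℕ} {z : ℕ → ℝ}
    (hmap : ∀ k, ∀ u ∈ K, (u + a k) / r ∈ K) (hzK : ∀ k, z k ∈ K)
    (hz : ∀ k, z k = (z (k + 1) + a k) / r)
    {L s t : ℕ} (hst : s < t) (h : ∀ k < L, a (s + k) = a (t + k)) :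
    ∃ p : ℤ, (p : ℝ) / ((r ^ s * (r ^ (t - s) - 1) : ℕ) : ℝ) ∈ K ∧
      |z 0 - p / ((r ^ s * (r ^ (t - s) - 1) : ℕ) : ℝ)| ≤
        1 / (((r ^ s * (r ^ (t - s) - 1) : ℕ) : ℝ) * (r : ℝ) ^ L) := by
  have hr0 : 0 < r := by omega
  have hrR : (0 : ℝ) < r := by positivity
  obtain ⟨B, hB, hzB⟩ := exists_block_map hr0 hmap hz 0 s
  obtain ⟨A, hA, hzA⟩ := exists_block_map hr0 hmap hz s (t - s)
  rw [zero_add] at hzB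
  rw [Nat.add_sub_cancel' hst.le] at hzA
  have hclose := abs_sub_le_of_digits_eq hr0 (fun k => h01K (hzK k)) hz L s t h
  have hcast : ((r ^ s * (r ^ (t - s) - 1) : ℕ) : ℝ)
      = (r : ℝ) ^ s * ((r : ℝ) ^ (t - s) - 1) := by
    rw [Nat.cast_mul, Nat.cast_sub (Nat.one_le_pow _ _ hr0)]
    simp
  rw [hcast]
  have hR1 : (1 : ℝ) < (r : ℝ) ^ (t - s) :=
    one_lt_pow₀ (by exact_mod_cast hr) (by omega)
  have hfix := fixedPoint_mem hK ⟨_, hzK 0⟩ hR1 hA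
  refine ⟨(A : ℤ) + B * ((r : ℤ) ^ (t - s) - 1), ?_⟩
  push_cast
  generalize (r : ℝ) ^ (t - s) = R at hR1 hzA hfix ⊢
  have hRpos : 0 < R := by linarith
  have hS : (0 : ℝ) < (r : ℝ) ^ s := by positivity
  have hRsub : 0 < R - 1 := by linarith
  have hAR : z s * R = z t + A := by
    rw [hzA]
    field_simp
  have hy : ((A : ℝ) + B * (R - 1)) / ((r : ℝ) ^ s * (R - 1)) =
      (A / (R - 1) + B) / (r : ℝ) ^ s := by
    field_simp
  have hdiff : z 0 - (A / (R - 1) + B) / (r : ℝ) ^ s = (z t - z s) / ((r : ℝ) ^ s * (R - 1)) := by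
    rw [hzB]
    field_simp
    linarith
  rw [hy]
  refine ⟨hB _ hfix, ?_⟩
  rw [hdiff, abs_div, abs_of_pos (mul_pos hS hRsub), mul_comm _ ((r : ℝ) ^ L),
    ← div_div 1]
  gcongr

/-- The number of tuples of words of lengths `⌊τ i * log N / log r⌋` is at most `N`. -/
lemma prod_card_pow_le {ι : Type*} [Fintype ι] {r : ℝ} (hr : 1 < r) (c : ι → ℕ)
    (hc : ∀ i, 0 < c i) {τ : ι → ℝ} (hτ : ∀ i, 0 < τ i)
    (hsum : ∑ i, τ i * (Real.log (c i) / Real.log r) = 1) {N : ℕ} (hN : 0 < N) :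
    ∏ i, c i ^ ⌊τ i * (Real.log N / Real.log r)⌋₊ ≤ N := by
  have hlogr : 0 < Real.log r := Real.log_pos hr
  have hN' : (0 : ℝ) < N := by exact_mod_cast hN
  have hlogN : 0 ≤ Real.log N := Real.log_natCast_nonneg N
  suffices h : (∏ i, (c i : ℝ) ^ ⌊τ i * (Real.log N / Real.log r)⌋₊) ≤ N by exact_mod_cast h
  calc (∏ i, (c i : ℝ) ^ ⌊τ i * (Real.log N / Real.log r)⌋₊)
      ≤ ∏ i, (N : ℝ) ^ (τ i * (Real.log (c i) / Real.log r)) := by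
        refine Finset.prod_le_prod (fun i _ => by positivity) fun i _ => ?_
        have hci : (0 : ℝ) < c i := by exact_mod_cast hc i
        have hlogc : 0 ≤ Real.log (c i) := Real.log_natCast_nonneg _
        rw [← Real.log_le_log_iff (by positivity) (by positivity), Real.log_pow,
          Real.log_rpow hN']
        have hfloor := Nat.floor_le (mul_nonneg (hτ i).le (div_nonneg hlogN hlogr.le))
        calc (⌊τ i * (Real.log N / Real.log r)⌋₊ : ℝ) * Real.log (c i)
            ≤ τ i * (Real.log N / Real.log r) * Real.log (c i) := by gcongr
          _ = τ i * (Real.log (c i) / Real.log r) * Real.log N := by ring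
    _ = N := by rw [← Real.rpow_sum_of_pos hN', hsum, Real.rpow_one]

/-- Digit sequences with values in `D i` admit, among the positions `0, …, N`, two positions at
which the words of lengths `L i` coincide, as soon as there are at most `N` tuples of words. -/
lemma exists_repeated_words {ι : Type*} [Fintype ι] (D : ι → Finset ℕ) (L : ι → ℕ)
    (a : ι → ℕ → ℕ) (ha : ∀ i k, a i k ∈ D i) {N : ℕ} (hN : ∏ i, (D i).card ^ L i ≤ N) :
    ∃ s t, s < t ∧ t ≤ N ∧ ∀ i, ∀ k < L i, a i (s + k) = a i (t + k) := by
  classical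
  obtain ⟨s, hs, t, ht, hne, heq⟩ := Finset.exists_ne_map_eq_of_card_lt_of_maps_to
    (s := Finset.range (N + 1))
    (t := Fintype.piFinset fun i => Fintype.piFinset fun _ : Fin (L i) => D i)
    (f := fun m i (k : Fin (L i)) => a i (m + k))
    (by simpa [Fintype.card_piFinset] using Nat.lt_succ_of_le hN)
    (fun m _ => by simp [ha])
  simp only [Finset.mem_range] at hs ht
  have hwords : ∀ i, ∀ k < L i, a i (s + k) = a i (t + k) := fun i k hk =>
    congrFun (congrFun heq i) ⟨k, hk⟩
  rcases lt_or_gt_of_ne hne with h | h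
  · exact ⟨s, t, h, by omega, hwords⟩
  · exact ⟨t, s, h, by omega, fun i k hk => (hwords i k hk).symm⟩

/-- A word length `⌊τ log_r N⌋` with `N = ⌊log_r Q⌋` is long enough. -/
lemma one_div_pow_floor_lt {r Q τ : ℝ} (hr : 1 < r) (hQ : r < Q) (hτ : 0 < τ) :
    1 / r ^ ⌊τ * (Real.log ⌊Real.log Q / Real.log r⌋₊ / Real.log r)⌋₊ <
      r * (2 * Real.log r) ^ τ / Real.log Q ^ τ := by
  have hlogr : 0 < Real.log r := Real.log_pos hr
  have hlogQ : Real.log r < Real.log Q := Real.log_lt_log (by linarith) hQ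
  have hN1 : 1 ≤ ⌊Real.log Q / Real.log r⌋₊ := by
    rw [Nat.one_le_floor_iff, one_le_div hlogr]
    exact hlogQ.le
  have hN2 : Real.log Q < 2 * Real.log r * ⌊Real.log Q / Real.log r⌋₊ := by
    have h1 := Nat.lt_floor_add_one (Real.log Q / Real.log r)
    have h2 : (1 : ℝ) ≤ ⌊Real.log Q / Real.log r⌋₊ := by exact_mod_cast hN1
    rw [div_lt_iff₀ hlogr] at h1
    nlinarith
  generalize ⌊Real.log Q / Real.log r⌋₊ = N at hN1 hN2 ⊢
  have hN : (0 : ℝ) < N := by exact_mod_cast hN1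
  have hpow : (N : ℝ) ^ τ < r * r ^ ⌊τ * (Real.log N / Real.log r)⌋₊ := by
    rw [← pow_succ', ← Real.log_lt_log_iff (by positivity) (by positivity), Real.log_rpow hN,
      Real.log_pow, ← div_lt_iff₀ hlogr, mul_div_assoc]
    exact_mod_cast Nat.lt_floor_add_one _
  rw [div_lt_div_iff₀ (by positivity) (Real.rpow_pos_of_pos (by linarith) _), one_mul]
  calc Real.log Q ^ τ ≤ (2 * Real.log r * N) ^ τ :=
        Real.rpow_le_rpow (by linarith) hN2.le hτ.le
    _ = (2 * Real.log r) ^ τ * (N : ℝ) ^ τ := Real.mul_rpow (by positivity) hN.le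
    _ < (2 * Real.log r) ^ τ * (r * r ^ ⌊τ * (Real.log N / Real.log r)⌋₊) := by gcongr
    _ = _ := by ring

/-- Theorem (weighted intrinsic Dirichlet on fractals): for the self-similar fractal
`K = ∏ K_j` with `γ_j = log #Λ_j / log r` and positive weights `τ` with
`∑ τ_i γ_i = 1`, there is `C > 0` such that for every `x ∈ K` and every real `Q > r`
there is a rational point `p/q ∈ ℚⁿ ∩ K` with `q ≤ Q` and
`|x_i − p_i/q| < C / (q (log Q)^{τ_i})` for all `i`. -/
theorem fractal_dirichlet (r n : ℕ) (hr : 2 ≤ r) (hn : 0 < n)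
    (D : Fin n → Finset ℕ) (hDne : ∀ j, (D j).Nonempty) (hD : ∀ j, ∀ a ∈ D j, a ≤ r - 1)
    (K : Fin n → Set ℝ)
    (hKcomp : ∀ j, IsCompact (K j)) (hKne : ∀ j, (K j).Nonempty)
    (hKsub : ∀ j, K j ⊆ Set.Icc 0 1)
    (hKattr : ∀ j, K j = ⋃ a ∈ D j, (fun x : ℝ => (x + a) / r) '' K j)
    (τ : Fin n → ℝ) (hτpos : ∀ i, 0 < τ i)
    (hτsum : ∑ i, τ i * (Real.log (D i).card / Real.log r) = 1) :
    ∃ C : ℝ, 0 < C ∧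
      ∀ x : Fin n → ℝ, (∀ j, x j ∈ K j) → ∀ Q : ℝ, (r : ℝ) < Q →
        ∃ (p : Fin n → ℤ) (q : ℕ), 0 < q ∧ (q : ℝ) ≤ Q ∧
          (∀ j, ((p j : ℝ) / q) ∈ K j) ∧
          ∀ i, |x i - p i / q| < C / (q * Real.log Q ^ τ i) := by
  have hr1 : (1 : ℝ) < r := by exact_mod_cast hr
  have hlogr : 0 < Real.log r := Real.log_pos hr1
  have hterm : ∀ i, 0 < (r : ℝ) * (2 * Real.log r) ^ τ i := fun i => by positivity
  refine ⟨∑ i, (r : ℝ) * (2 * Real.log r) ^ τ i,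
    Finset.sum_pos (fun i _ => hterm i) ⟨⟨0, hn⟩, Finset.mem_univ _⟩, fun x hx Q hQ => ?_⟩
  have hlogQ : Real.log r < Real.log Q := Real.log_lt_log (by linarith) hQ
  choose a z hz0 ha hzK hz using fun j => exists_digits_orbit (hKattr j) (hx j)
  have hmap : ∀ j k, ∀ u ∈ K j, (u + a j k) / r ∈ K j := by
    intro j k u hu
    rw [hKattr j]
    exact Set.mem_biUnion (ha j k) ⟨u, hu, rfl⟩
  have hN : 0 < ⌊Real.log Q / Real.log r⌋₊ := by
    rw [Nat.floor_pos, one_le_div hlogr]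
    exact hlogQ.le
  obtain ⟨s, t, hst, htN, hwords⟩ := exists_repeated_words D _ a ha
    (prod_card_pow_le hr1 (fun i => (D i).card) (fun i => (hDne i).card_pos) hτpos hτsum hN)
  choose p hpK hp using fun j =>
    exists_rational_approx hr (hKcomp j) (hKsub j) (hmap j) (hzK j) (hz j) hst (hwords j)
  have hq : 0 < r ^ s * (r ^ (t - s) - 1) :=
    Nat.mul_pos (by positivity) (Nat.sub_pos_of_lt (Nat.one_lt_pow (by omega) (by omega)))
  have hqt : r ^ s * (r ^ (t - s) - 1) ≤ r ^ t := by
    calc r ^ s * (r ^ (t - s) - 1) ≤ r ^ s * r ^ (t - s) := by gcongr; omega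
      _ = r ^ t := by rw [← pow_add, Nat.add_sub_cancel' hst.le]
  have htQ : (r : ℝ) ^ t ≤ Q := by
    rw [← Real.log_le_log_iff (by positivity) (by linarith), Real.log_pow, ← le_div_iff₀ hlogr]
    exact (Nat.le_floor_iff (div_nonneg (by linarith) hlogr.le)).1 htN
  refine ⟨p, _, hq, le_trans (by exact_mod_cast hqt) htQ, hpK, fun i => ?_⟩
  have hp' := hp i
  rw [hz0] at hp'
  refine hp'.trans_lt ?_
  have hqR : (0 : ℝ) < ((r ^ s * (r ^ (t - s) - 1) : ℕ) : ℝ) := by exact_mod_cast hq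
  have hpos : 0 < Real.log Q ^ τ i := Real.rpow_pos_of_pos (by linarith) _
  rw [← div_div, div_right_comm, ← div_div, div_right_comm (∑ i, _)]
  refine div_lt_div_of_pos_right ?_ hqR
  refine (one_div_pow_floor_lt hr1 hQ (hτpos i)).trans_le ?_
  refine div_le_div_of_nonneg_right ?_ hpos.le
  exact Finset.single_le_sum (f := fun i => (r : ℝ) * (2 * Real.log r) ^ τ i)
    (fun j _ => (hterm j).le) (Finset.mem_univ i)
end

section
/- Let K = ∏_{j=1}^n K_j be as in the rational self-similar fractal setup with γ_j = log(#Λ_j)/log r, and let τ = (τ_1,…,τ_n) ∈ ℝ^n_{>0} satisfy Σ_{i=1}^n τ_i γ_i = 1. Then there exists a constant C > 0 such that for every x = (x_1,…,x_n) ∈ K \ ℚ^n there exist infinitely many rational points p/q = (p_1/q,…,p_n/q) ∈ ℚ^n ∩ K (q ∈ ℕ) with |x_i − p_i/q| < C/(q·(log q)^{τ_i}) for all 1 ≤ i ≤ n. -/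
/-- The integer whose base-`r` digits are `a k, …, a (k + m - 1)`, most significant first. -/
def digitWord (r : ℕ) (a : ℕ → ℕ) (k : ℕ) : ℕ → ℕ
  | 0 => 0
  | m + 1 => r * digitWord r a k m + a (k + m)

theorem digitWord_congr (r : ℕ) (a : ℕ → ℕ) (k l m : ℕ)
    (h : ∀ i < m, a (k + i) = a (l + i)) : digitWord r a k m = digitWord r a l m := by
  induction m with
  | zero => rfl
  | succ m ih =>
    simp only [digitWord]
    rw [ih fun i hi => h i (hi.trans m.lt_succ_self), h m m.lt_succ_self]

/-- Every point of the attractor has a digit expansion, all of whose tails lie in the attractor. -/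
theorem exists_digit_expansion {r : ℕ} {D : Finset ℕ} {K : Set ℝ}
    (hK : K = ⋃ a ∈ D, (fun x : ℝ => (x + a) / r) '' K) {x : ℝ} (hx : x ∈ K) :
    ∃ (X : ℕ → ℝ) (a : ℕ → ℕ), X 0 = x ∧ (∀ k, X k ∈ K) ∧ (∀ k, a k ∈ D) ∧
      ∀ k, X k = (X (k + 1) + a k) / r := by
  have step : ∀ y : K, ∃ p : K × ℕ, p.2 ∈ D ∧ (y : ℝ) = ((p.1 : ℝ) + p.2) / r := by
    rintro ⟨y, hy⟩
    rw [hK] at hy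
    simp only [Set.mem_iUnion, Set.mem_image] at hy
    obtain ⟨a, ha, z, hz, rfl⟩ := hy
    exact ⟨(⟨z, hz⟩, a), ha, rfl⟩
  choose g hgD hg using step
  let Y : ℕ → K := fun k => (fun y => (g y).1)^[k] ⟨x, hx⟩
  refine ⟨fun k => Y k, fun k => (g (Y k)).2, rfl, fun k => (Y k).2, fun k => hgD _, fun k => ?_⟩
  have hY : Y (k + 1) = (g (Y k)).1 := Function.iterate_succ_apply' _ _ _
  simp only [hY]
  exact hg (Y k)

theorem tail_eq_digitWord {r : ℕ} (hr : 2 ≤ r) {X : ℕ → ℝ} {a : ℕ → ℕ}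
    (hX : ∀ k, X k = (X (k + 1) + a k) / r) (k m : ℕ) :
    X k = (X (k + m) + digitWord r a k m) / (r : ℝ) ^ m := by
  have hr0 : (r : ℝ) ≠ 0 := by positivity
  induction m with
  | zero => simp [digitWord]
  | succ m ih =>
    rw [ih, hX (k + m), ← add_assoc]
    simp only [digitWord]
    push_cast
    field_simp
    ring

theorem digitWord_map_mem {r : ℕ} (hr : 2 ≤ r) {D : Finset ℕ} {K : Set ℝ}
    (hK : K = ⋃ a ∈ D, (fun x : ℝ => (x + a) / r) '' K) {a : ℕ → ℕ} (ha : ∀ k, a k ∈ D)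
    (k m : ℕ) {y : ℝ} (hy : y ∈ K) : (y + digitWord r a k m) / (r : ℝ) ^ m ∈ K := by
  have hr0 : (r : ℝ) ≠ 0 := by positivity
  induction m generalizing y with
  | zero => simpa [digitWord] using hy
  | succ m ih =>
    have hmem : (y + a (k + m)) / (r : ℝ) ∈ K := by
      rw [hK]
      exact Set.mem_biUnion (ha (k + m)) ⟨y, hy, rfl⟩
    convert ih hmem using 1
    simp only [digitWord]
    push_cast
    field_simp
    ring

/-- The point with purely periodic digit expansion lies in the attractor. -/
theorem periodic_point_mem {r : ℕ} (hr : 2 ≤ r) {D : Finset ℕ} {K : Set ℝ} (hc : IsClosed K)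
    (hne : K.Nonempty) (hK : K = ⋃ a ∈ D, (fun x : ℝ => (x + a) / r) '' K) {a : ℕ → ℕ}
    (ha : ∀ k, a k ∈ D) (k L : ℕ) (hL : L ≠ 0) :
    (digitWord r a k L : ℝ) / ((r : ℝ) ^ L - 1) ∈ K := by
  obtain ⟨y, hy⟩ := hne
  have hr1 : (1 : ℝ) < r := by exact_mod_cast hr
  have hrL : 1 < (r : ℝ) ^ L := one_lt_pow₀ hr1 hL
  set z := (digitWord r a k L : ℝ) / ((r : ℝ) ^ L - 1) with hz
  have hmem : ∀ t : ℕ, z + (y - z) * ((r : ℝ) ^ L)⁻¹ ^ t ∈ K := by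
    intro t
    induction t with
    | zero => simpa using hy
    | succ t ih =>
      have h := digitWord_map_mem hr hK ha k L ih
      have hw : (digitWord r a k L : ℝ) = z * ((r : ℝ) ^ L - 1) := by
        rw [hz, div_mul_cancel₀ _ (by linarith)]
      convert h using 1
      rw [hw, pow_succ]
      field_simp
      ring
  have hlim : Filter.Tendsto (fun t : ℕ => z + (y - z) * ((r : ℝ) ^ L)⁻¹ ^ t) Filter.atTop
      (nhds z) := by
    have h0 := tendsto_pow_atTop_nhds_zero_of_lt_one (r := ((r : ℝ) ^ L)⁻¹) (by positivity)
      (inv_lt_one_of_one_lt₀ hrL)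
    simpa using (h0.const_mul (y - z)).const_add z
  exact hc.mem_of_tendsto hlim (Filter.Eventually.of_forall hmem)

/-- If the tails at `k` and `k + L` agree to `m` digits, closing up the block between them gives
a rational point of the attractor that approximates the original point. -/
theorem exists_eventually_periodic_approx {r : ℕ} (hr : 2 ≤ r) {D : Finset ℕ} {K : Set ℝ}
    (hc : IsClosed K) (hsub : K ⊆ Set.Icc 0 1)
    (hK : K = ⋃ a ∈ D, (fun x : ℝ => (x + a) / r) '' K) {X : ℕ → ℝ} {a : ℕ → ℕ}
    (hXK : ∀ k, X k ∈ K) (ha : ∀ k, a k ∈ D) (hX : ∀ k, X k = (X (k + 1) + a k) / r)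
    (k L m : ℕ) (hL : L ≠ 0) (hkl : ∀ i < m, a (k + i) = a (k + L + i)) :
    ∃ p : ℤ, (p : ℝ) / ((r ^ (k + 1) * (r ^ L - 1) : ℕ) : ℝ) ∈ K ∧
      |X 0 - p / ((r ^ (k + 1) * (r ^ L - 1) : ℕ) : ℝ)| ≤ 2 / ((r : ℝ) ^ (k + L) * r ^ m) := by
  have hr1 : (1 : ℝ) < r := by exact_mod_cast hr
  have hr2 : (2 : ℝ) ≤ r := by exact_mod_cast hr
  have hr0 : (0 : ℝ) < r := by linarith
  have hrL : 2 ≤ (r : ℝ) ^ L := hr2.trans (le_self_pow₀ hr1.le hL)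
  have hcast : ((r ^ (k + 1) * (r ^ L - 1) : ℕ) : ℝ) = (r : ℝ) ^ (k + 1) * ((r : ℝ) ^ L - 1) := by
    rw [Nat.cast_mul, Nat.cast_sub (Nat.one_le_pow _ _ (by omega))]
    push_cast
    ring
  set z := (digitWord r a k L : ℝ) / ((r : ℝ) ^ L - 1) with hz
  have hzK : z ∈ K := periodic_point_mem hr hc ⟨_, hXK 0⟩ hK ha k L hL
  have hw : (digitWord r a k L : ℝ) = z * ((r : ℝ) ^ L - 1) := by
    rw [hz, div_mul_cancel₀ _ (by linarith)]
  have hyK := digitWord_map_mem hr hK ha 0 k hzK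
  have hp : (((r * (digitWord r a k L + (r ^ L - 1) * digitWord r a 0 k) : ℤ)) : ℝ) /
      ((r ^ (k + 1) * (r ^ L - 1) : ℕ) : ℝ) = (z + digitWord r a 0 k) / (r : ℝ) ^ k := by
    have hne : (r : ℝ) ^ L - 1 ≠ 0 := by linarith
    rw [hcast]
    push_cast
    rw [hw]
    field_simp
    ring
  refine ⟨r * (digitWord r a k L + (r ^ L - 1) * digitWord r a 0 k), hp ▸ hyK, ?_⟩
  rw [hp]
  have h0 : X 0 = (X k + digitWord r a 0 k) / (r : ℝ) ^ k := by
    simpa using tail_eq_digitWord hr hX 0 k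
  have hkL : X k - z = (X (k + L) - z) / (r : ℝ) ^ L := by
    rw [tail_eq_digitWord hr hX k L, hw]
    field_simp
    ring
  have hclose : |X k - X (k + L)| ≤ 1 / (r : ℝ) ^ m := by
    rw [tail_eq_digitWord hr hX k m, tail_eq_digitWord hr hX (k + L) m,
      digitWord_congr r a k (k + L) m hkl, ← sub_div, add_sub_add_right_eq_sub, abs_div,
      abs_of_pos (by positivity : (0 : ℝ) < (r : ℝ) ^ m)]
    gcongr
    have h1 := hsub (hXK (k + m))
    have h2 := hsub (hXK (k + L + m))
    rw [abs_le]
    constructor <;> linarith [h1.1, h1.2, h2.1, h2.2]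
  have hdiff : |X (k + L) - z| ≤ 2 / (r : ℝ) ^ m := by
    have h3 : |X k - z| ≤ |X (k + L) - z| / 2 := by
      rw [hkL, abs_div, abs_of_pos (by positivity : (0 : ℝ) < (r : ℝ) ^ L)]
      gcongr
    have h4 : |X (k + L) - z| ≤ |X (k + L) - X k| + |X k - z| := abs_sub_le _ _ _
    rw [abs_sub_comm (X (k + L)) (X k)] at h4
    have h5 : 2 / (r : ℝ) ^ m = 2 * (1 / (r : ℝ) ^ m) := by ring
    linarith
  have hfin : X 0 - (z + digitWord r a 0 k) / (r : ℝ) ^ k = (X (k + L) - z) / (r : ℝ) ^ (k + L) := by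
    rw [h0, ← sub_div, add_sub_add_right_eq_sub, hkL, pow_add]
    field_simp
  rw [hfin, abs_div, abs_of_pos (by positivity : (0 : ℝ) < (r : ℝ) ^ (k + L)), mul_comm, ← div_div]
  gcongr

/-- The number of digit patterns of lengths `⌊τ_j log_r N⌋` is at most `N`. -/
theorem prod_card_pow_floor_le {ι : Type*} [Fintype ι] {r N : ℕ} (hr : 2 ≤ r) (hN : 1 ≤ N)
    (c : ι → ℕ) (hc : ∀ j, 1 ≤ c j) (τ : ι → ℝ) (hτ : ∀ j, 0 < τ j)
    (hsum : ∑ i, τ i * (Real.log (c i) / Real.log r) = 1) :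
    ∏ j, c j ^ ⌊τ j * Real.log N / Real.log r⌋₊ ≤ N := by
  have hlr : 0 < Real.log r := Real.log_pos (by exact_mod_cast hr)
  have hlN : 0 ≤ Real.log N := Real.log_natCast_nonneg N
  have hNpos : (0 : ℝ) < N := by exact_mod_cast hN
  have hle : ∀ j, ((c j : ℝ) ^ ⌊τ j * Real.log N / Real.log r⌋₊) ≤
      Real.exp (τ j * (Real.log (c j) / Real.log r) * Real.log N) := by
    intro j
    have hcj : (0 : ℝ) < c j := by exact_mod_cast hc j
    rw [← Real.exp_log (pow_pos hcj _), Real.log_pow]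
    apply Real.exp_le_exp.mpr
    have hnn : 0 ≤ τ j * Real.log N / Real.log r := by have := hτ j; positivity
    calc _ ≤ τ j * Real.log N / Real.log r * Real.log (c j) := by
          have := Real.log_natCast_nonneg (c j)
          gcongr
          exact Nat.floor_le hnn
      _ = _ := by ring
  have hprod : ∏ j, ((c j : ℝ) ^ ⌊τ j * Real.log N / Real.log r⌋₊) ≤ N :=
    calc _ ≤ ∏ j, Real.exp (τ j * (Real.log (c j) / Real.log r) * Real.log N) :=
          Finset.prod_le_prod (fun _ _ => by positivity) fun j _ => hle j
      _ = N := by rw [← Real.exp_sum, ← Finset.sum_mul, hsum, one_mul, Real.exp_log hNpos]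
  exact_mod_cast hprod

theorem rpow_le_mul_pow_floor {r N : ℕ} (hr : 2 ≤ r) (hN : 1 ≤ N) (t : ℝ) :
    (N : ℝ) ^ t ≤ r * (r : ℝ) ^ ⌊t * Real.log N / Real.log r⌋₊ := by
  have hlr : 0 < Real.log r := Real.log_pos (by exact_mod_cast hr)
  have hNpos : (0 : ℝ) < N := by exact_mod_cast hN
  have hrpos : (0 : ℝ) < r := by positivity
  rw [← pow_succ', Real.rpow_def_of_pos hNpos, ← Real.exp_log (pow_pos hrpos _), Real.log_pow]
  apply Real.exp_le_exp.mpr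
  have := (Nat.lt_floor_add_one (t * Real.log N / Real.log r)).le
  rw [div_le_iff₀ hlr] at this
  push_cast
  linarith

/-- Dirichlet-type theorem: for every `N` there is a rational point of the product attractor of
denominator less than `r ^ (N + 1)` with the given quality of approximation. -/
theorem exists_rational_approx_s16 {r : ℕ} (hr : 2 ≤ r) {ι : Type*} [Fintype ι]
    {D : ι → Finset ℕ} (hDne : ∀ j, (D j).Nonempty) {K : ι → Set ℝ}
    (hKcl : ∀ j, IsClosed (K j)) (hKsub : ∀ j, K j ⊆ Set.Icc 0 1)
    (hKattr : ∀ j, K j = ⋃ a ∈ D j, (fun x : ℝ => (x + a) / r) '' K j)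
    {τ : ι → ℝ} (hτpos : ∀ i, 0 < τ i)
    (hτsum : ∑ i, τ i * (Real.log (D i).card / Real.log r) = 1)
    {x : ι → ℝ} (hx : ∀ j, x j ∈ K j) {N : ℕ} (hN : 1 ≤ N) :
    ∃ (p : ι → ℤ) (q : ℕ), 2 ≤ q ∧ q < r ^ (N + 1) ∧ (∀ j, (p j : ℝ) / q ∈ K j) ∧
      ∀ j, |x j - p j / q| < 2 * r ^ 2 / (q * (N : ℝ) ^ τ j) := by
  classical
  choose X a hX0 hXK ha hX using fun j => exists_digit_expansion (hKattr j) (hx j)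
  set m : ι → ℕ := fun j => ⌊τ j * Real.log N / Real.log r⌋₊
  have hcard : Fintype.card (∀ j, Fin (m j) → D j) < Fintype.card (Fin (N + 1)) := by
    have := prod_card_pow_floor_le hr hN (fun j => (D j).card)
      (fun j => (hDne j).card_pos) τ hτpos hτsum
    simpa [Fintype.card_pi] using Nat.lt_succ_of_le this
  obtain ⟨k, l, hkl, heq⟩ : ∃ k l : Fin (N + 1), k < l ∧
      ∀ j, ∀ i < m j, a j (k + i) = a j (l + i) := by
    obtain ⟨k, l, hne, h⟩ := Fintype.exists_ne_map_eq_of_card_lt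
      (fun (k : Fin (N + 1)) j (i : Fin (m j)) => (⟨a j (k + i), ha j _⟩ : D j)) hcard
    have h' : ∀ j, ∀ i < m j, a j (k + i) = a j (l + i) := fun j i hi =>
      congrArg Subtype.val (congrFun (congrFun h j) ⟨i, hi⟩)
    rcases lt_or_gt_of_ne hne with hlt | hlt
    · exact ⟨k, l, hlt, h'⟩
    · exact ⟨l, k, hlt, fun j i hi => (h' j i hi).symm⟩
  obtain ⟨L, hL⟩ := Nat.exists_eq_add_of_lt (Fin.lt_def.mp hkl)
  replace hL : (l : ℕ) = k + (L + 1) := by omega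
  choose p hpK hp using fun j => exists_eventually_periodic_approx hr (hKcl j) (hKsub j)
    (hKattr j) (hXK j) (ha j) (hX j) k (L + 1) (m j) L.succ_ne_zero
    (by simpa only [hL] using heq j)
  set q := r ^ ((k : ℕ) + 1) * (r ^ (L + 1) - 1)
  have hrL : 2 ≤ r ^ (L + 1) := hr.trans (Nat.le_self_pow L.succ_ne_zero r)
  have hq2 : 2 ≤ q := by
    have h1 : 2 ≤ r ^ ((k : ℕ) + 1) := hr.trans (Nat.le_self_pow (Nat.succ_ne_zero _) r)
    calc 2 = 2 * 1 := rfl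
      _ ≤ q := Nat.mul_le_mul h1 (by omega)
  have hql : q < r ^ ((l : ℕ) + 1) := by
    calc q < r ^ ((k : ℕ) + 1) * r ^ (L + 1) :=
          Nat.mul_lt_mul_of_pos_left (by omega) (by positivity)
      _ = r ^ ((l : ℕ) + 1) := by rw [hL, ← pow_add]; congr 1; omega
  refine ⟨p, q, hq2, hql.trans_le (Nat.pow_le_pow_right (by omega) l.2), hpK, fun j => ?_⟩
  have hqpos : (0 : ℝ) < q := by exact_mod_cast (by omega : 0 < q)
  have hNpos : (0 : ℝ) < N := by exact_mod_cast hN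
  have hrpos : (0 : ℝ) < r := by positivity
  have hqlR : (q : ℝ) < r * (r : ℝ) ^ (l : ℕ) := by rw [← pow_succ']; exact_mod_cast hql
  have hNτ := rpow_le_mul_pow_floor hr hN (τ j)
  rw [← hX0 j]
  refine (hp j).trans_lt ?_
  rw [← hL, div_lt_div_iff₀ (by positivity) (by positivity)]
  calc 2 * ((q : ℝ) * (N : ℝ) ^ τ j) < 2 * ((r * (r : ℝ) ^ (l : ℕ)) * (N : ℝ) ^ τ j) := by
        gcongr
    _ ≤ 2 * ((r * (r : ℝ) ^ (l : ℕ)) * (r * (r : ℝ) ^ m j)) := by gcongr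
    _ = 2 * r ^ 2 * ((r : ℝ) ^ (l : ℕ) * r ^ m j) := by ring

/-- Corollary: for the self-similar fractal `K = ∏ K_j` with `γ_j = log #Λ_j / log r`
and positive weights `τ` with `∑ τ_i γ_i = 1`, there is `C > 0` such that every
`x ∈ K \ ℚⁿ` admits infinitely many rational points `p/q ∈ ℚⁿ ∩ K` with
`|x_i − p_i/q| < C / (q (log q)^{τ_i})` for all `i`. -/
theorem fractal_dirichlet_infinitely_many (r n : ℕ) (hr : 2 ≤ r) (hn : 0 < n)
    (D : Fin n → Finset ℕ) (hDne : ∀ j, (D j).Nonempty) (hD : ∀ j, ∀ a ∈ D j, a ≤ r - 1)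
    (K : Fin n → Set ℝ)
    (hKcomp : ∀ j, IsCompact (K j)) (hKne : ∀ j, (K j).Nonempty)
    (hKsub : ∀ j, K j ⊆ Set.Icc 0 1)
    (hKattr : ∀ j, K j = ⋃ a ∈ D j, (fun x : ℝ => (x + a) / r) '' K j)
    (τ : Fin n → ℝ) (hτpos : ∀ i, 0 < τ i)
    (hτsum : ∑ i, τ i * (Real.log (D i).card / Real.log r) = 1) :
    ∃ C : ℝ, 0 < C ∧
      ∀ x : Fin n → ℝ, (∀ j, x j ∈ K j) → (¬ ∀ i, ∃ s : ℚ, x i = (s : ℝ)) →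
        {pq : (Fin n → ℤ) × ℕ | 0 < pq.2 ∧ (∀ j, ((pq.1 j : ℝ) / pq.2) ∈ K j) ∧
          ∀ i, |x i - pq.1 i / pq.2| < C / (pq.2 * Real.log pq.2 ^ τ i)}.Infinite := by
  have hr1 : (1 : ℝ) < r := by exact_mod_cast hr
  have hrpos : (0 : ℝ) < r := by linarith
  refine ⟨2 * r ^ 2 * (2 * r) ^ ∑ i, τ i, by positivity, fun x hx hirr => ?_⟩
  push Not at hirr
  obtain ⟨i₀, hi₀⟩ := hirr
  set S := {pq : (Fin n → ℤ) × ℕ | 0 < pq.2 ∧ (∀ j, ((pq.1 j : ℝ) / pq.2) ∈ K j) ∧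
    ∀ i, |x i - pq.1 i / pq.2| <
      2 * r ^ 2 * (2 * r) ^ (∑ i, τ i) / (pq.2 * Real.log pq.2 ^ τ i)}
  have key : ∀ N : ℕ, 1 ≤ N → ∃ pq ∈ S,
      |x i₀ - pq.1 i₀ / pq.2| < 2 * r ^ 2 / (N : ℝ) ^ τ i₀ := by
    intro N hN
    obtain ⟨p, q, hq2, hqN, hpK, hp⟩ := exists_rational_approx_s16 hr hDne
      (fun j => (hKcomp j).isClosed) hKsub hKattr hτpos hτsum hx hN
    have hq1 : (1 : ℝ) < q := by exact_mod_cast hq2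
    have hN1 : (1 : ℝ) ≤ N := by exact_mod_cast hN
    have hlq : 0 < Real.log q := Real.log_pos hq1
    have hlog : Real.log q ≤ 2 * r * N := by
      have h1 : Real.log q ≤ Real.log ((r : ℝ) ^ (N + 1)) :=
        Real.log_le_log (by linarith) (by exact_mod_cast hqN.le)
      rw [Real.log_pow] at h1
      push_cast at h1
      have h2 : Real.log r ≤ r := Real.log_le_self hrpos.le
      calc Real.log q ≤ (N + 1) * Real.log r := h1
        _ ≤ (N + N) * r := by gcongr
        _ = 2 * r * N := by ring
    refine ⟨(p, q), ⟨by dsimp only; omega, hpK, fun i => (hp i).trans_le ?_⟩,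
      (hp i₀).trans_le ?_⟩
    · have hpow : Real.log q ^ τ i ≤ (2 * r) ^ (∑ i, τ i) * (N : ℝ) ^ τ i := by
        calc Real.log q ^ τ i ≤ (2 * r * N) ^ τ i :=
              Real.rpow_le_rpow hlq.le hlog (hτpos i).le
          _ = (2 * r) ^ τ i * (N : ℝ) ^ τ i := Real.mul_rpow (by positivity) (by positivity)
          _ ≤ (2 * r) ^ (∑ i, τ i) * (N : ℝ) ^ τ i := by
              gcongr
              · linarith
              · exact Finset.single_le_sum (fun j _ => (hτpos j).le) (Finset.mem_univ i)
      have hlp : 0 < Real.log q ^ τ i := Real.rpow_pos_of_pos hlq _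
      rw [div_le_div_iff₀ (by positivity) (by positivity)]
      calc 2 * (r : ℝ) ^ 2 * (q * Real.log q ^ τ i)
          ≤ 2 * (r : ℝ) ^ 2 * (q * ((2 * r) ^ (∑ i, τ i) * (N : ℝ) ^ τ i)) := by gcongr
        _ = _ := by ring
    · gcongr
      exact le_mul_of_one_le_left (by positivity) hq1.le
  intro hfin
  obtain ⟨pq₁, hpq₁, -⟩ := key 1 le_rfl
  obtain ⟨pq, -, hmin⟩ := Set.exists_min_image S (fun pq => |x i₀ - pq.1 i₀ / pq.2|) hfin
    ⟨pq₁, hpq₁⟩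
  have hpos : 0 < |x i₀ - pq.1 i₀ / pq.2| := by
    rw [abs_pos, sub_ne_zero]
    have := hi₀ ((pq.1 i₀ : ℚ) / pq.2)
    push_cast at this
    exact this
  have hlim : Filter.Tendsto (fun N : ℕ => 2 * (r : ℝ) ^ 2 / (N : ℝ) ^ τ i₀) Filter.atTop
      (nhds 0) :=
    ((tendsto_rpow_atTop (hτpos i₀)).comp tendsto_natCast_atTop_atTop).const_div_atTop _
  obtain ⟨N, hlt, hN⟩ := ((hlim.eventually_lt_const hpos).and
    (Filter.eventually_ge_atTop 1)).exists
  obtain ⟨pq', hpq', hclose⟩ := key N hN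
  exact absurd (hmin pq' hpq') (not_le.mpr (hclose.trans hlt))
end

section
/- Let d, m ∈ ℕ, n = d + m, and let f = (f_1,…,f_m) : U → ℝ^m be a C² map defined on an open subset U ⊆ ℝ^d; define F : U → ℝ^n by F(x) = (x, f(x)). Let τ = (τ_1,…,τ_n) ∈ ℝ^n_{>0} satisfy Σ_{i=1}^n τ_i = 1 and min_{1≤i≤d} τ_i ≥ max_{1≤j≤m} τ_{d+j}. Then λ_d(F^{-1}(Bad_n(τ))) = 0, where λ_d is d-dimensional Lebesgue measure. -/
open MeasureTheory

/-- The set `Bad_n(τ)` of `τ`-weighted badly approximable points of `ℝⁿ`: points `x`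
for which there is `c(x) > 0` with `max_i q^{τ_i} |q x_i − p_i| ≥ c(x)`, i.e. for every
`(p, q) ∈ ℤⁿ × ℕ` some coordinate satisfies `|q x_i − p_i| ≥ c(x) / q^{τ_i}`. -/
def BadReal (n : ℕ) (τ : Fin n → ℝ) : Set (Fin n → ℝ) :=
  {x | ∃ c : ℝ, 0 < c ∧ ∀ (p : Fin n → ℤ) (q : ℕ), 0 < q →
    ∃ i, c / (q : ℝ) ^ τ i ≤ |(q : ℝ) * x i - p i|}

open Filter Topology Metric

/-- **Dirichlet's theorem** for a unipotent triangular system of linear forms. -/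
theorem exists_int_approx_of_prod_le {d m : ℕ} (x : Fin d → ℝ) (y : Fin m → ℝ)
    (L : (Fin d → ℝ) →ₗ[ℝ] (Fin m → ℝ)) (a : Fin d → ℕ) (b : Fin m → ℕ)
    (ha : ∀ i, 0 < a i) (hb : ∀ j, 0 < b j) (N : ℕ) (hN : (∏ i, a i) * ∏ j, b j ≤ N) :
    ∃ (q : ℕ) (p : Fin d → ℤ) (r : Fin m → ℤ), 0 < q ∧ q ≤ N ∧
      (∀ i, |q * x i - p i| ≤ 1 / a i) ∧
      ∀ j, |q * y j + L (fun i => p i - q * x i) j - r j| ≤ 1 / b j := by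
  have floor_lt : ∀ (k : ℕ) (t : ℝ), 0 < k → ⌊Int.fract t * k⌋₊ < k := by
    intro k t hk
    have hk' : (0 : ℝ) < k := by exact_mod_cast hk
    rw [Nat.floor_lt (by positivity)]
    nlinarith [Int.fract_lt_one t]
  have abs_sub_le : ∀ (k : ℕ) (s t : ℝ), 0 < k →
      ⌊Int.fract s * k⌋₊ = ⌊Int.fract t * k⌋₊ → |Int.fract s - Int.fract t| ≤ 1 / k := by
    intro k s t hk h
    have hk' : (0 : ℝ) < k := by exact_mod_cast hk
    have h1 := Nat.floor_le (a := Int.fract s * k) (by positivity)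
    have h2 := Nat.lt_floor_add_one (Int.fract s * k)
    have h3 := Nat.floor_le (a := Int.fract t * k) (by positivity)
    have h4 := Nat.lt_floor_add_one (Int.fract t * k)
    rw [h] at h1 h2
    rw [le_div_iff₀ hk', ← Nat.abs_cast k, ← abs_mul, abs_le]
    constructor <;> nlinarith
  let P : ℕ → Fin d → ℤ := fun q i => ⌊q * x i⌋
  let z : ℕ → Fin m → ℝ := fun q j => q * y j + L (fun i => P q i - q * x i) j
  let g : Fin (N + 1) → (∀ i, Fin (a i)) × (∀ j, Fin (b j)) := fun q =>
    (fun i => ⟨⌊Int.fract ((q : ℕ) * x i) * a i⌋₊, floor_lt _ _ (ha i)⟩,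
      fun j => ⟨⌊Int.fract (z q j) * b j⌋₊, floor_lt _ _ (hb j)⟩)
  obtain ⟨u, v, huv, hg⟩ : ∃ u v, u < v ∧ g u = g v := by
    obtain ⟨u, v, huv, hg⟩ := Fintype.exists_ne_map_eq_of_card_lt g (by
      simpa [Fintype.card_prod, Fintype.card_pi] using Nat.lt_succ_of_le hN)
    rcases lt_or_gt_of_ne huv with h | h
    · exact ⟨u, v, h, hg⟩
    · exact ⟨v, u, h, hg.symm⟩
  have huv' : (u : ℕ) < v := huv
  have hcast : (((v : ℕ) - (u : ℕ) : ℕ) : ℝ) = (v : ℕ) - (u : ℕ) := Nat.cast_sub huv'.le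
  refine ⟨v - u, fun i => P v i - P u i, fun j => ⌊z v j⌋ - ⌊z u j⌋, by omega, by omega,
    fun i => ?_, fun j => ?_⟩
  · have h := congrArg (fun t => (t.1 i : ℕ)) hg
    have := abs_sub_le _ _ _ (ha i) h.symm
    rw [hcast]
    simp only [Int.fract] at this
    convert this using 2
    simp only [P]
    push_cast
    ring
  · have h := congrArg (fun t => (t.2 j : ℕ)) hg
    have := abs_sub_le _ _ _ (hb j) h.symm
    rw [hcast]
    simp only [Int.fract] at this
    convert this using 2
    have hL : L (fun i => ((P v i - P u i : ℤ) : ℝ) - ((v : ℕ) - (u : ℕ)) * x i) =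
        L (fun i => P v i - (v : ℕ) * x i) - L (fun i => P u i - (u : ℕ) * x i) := by
      rw [← map_sub]
      congr 1
      funext i
      simp only [Pi.sub_apply]
      push_cast
      ring
    rw [hL]
    simp only [z, Pi.sub_apply]
    push_cast
    ring

instance (α : ℝ) (h₀ : 0 < α) (h₁ : α ≤ 1) : MeasurableSpace (Snowflaking ℝ α h₀ h₁) := borel _

instance (α : ℝ) (h₀ : 0 < α) (h₁ : α ≤ 1) : BorelSpace (Snowflaking ℝ α h₀ h₁) := ⟨rfl⟩

/-- **Lebesgue's density theorem** for boxes with sides `δ ^ a i`: almost every point `x` of `S` is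
such that, if the `K`-dilations of shrinking boxes contain `x`, then the boxes meet `S`. -/
theorem ae_restrict_eventually_box_inter_nonempty {d : ℕ} (a : Fin d → ℝ) (ha : ∀ i, 1 ≤ a i)
    (S : Set (Fin d → ℝ)) (K : ℝ) :
    ∀ᵐ x ∂volume.restrict S, ∀ (w : ℕ → Fin d → ℝ) (δ : ℕ → ℝ), Tendsto δ atTop (𝓝[>] 0) →
      (∀ᶠ Q in atTop, 0 ≤ K * δ Q ∧ ∀ i, |x i - w Q i| ≤ (K * δ Q) ^ a i) →
      ∀ᶠ Q in atTop, ∃ y ∈ S, ∀ i, |y i - w Q i| ≤ δ Q ^ a i := by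
  have ha₀ : ∀ i, 0 < a i := fun i => zero_lt_one.trans_le (ha i)
  let Z := ∀ i, Snowflaking ℝ (a i)⁻¹ (inv_pos.2 (ha₀ i)) (inv_le_one_of_one_le₀ (ha i))
  let e : Z ≃ₜ (Fin d → ℝ) := Homeomorph.piCongrRight fun i => Snowflaking.homeomorph
  let E : Z ≃ᵐ (Fin d → ℝ) := e.toMeasurableEquiv
  let μ : Measure Z := volume.map E.symm
  have hE : MeasurePreserving E μ volume := ⟨E.measurable, by simp [μ]⟩
  have mem_ball : ∀ (z w : Z) (r : ℝ), 0 ≤ r →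
      (z ∈ closedBall w r ↔ ∀ i, |E z i - E w i| ≤ r ^ a i) := by
    intro z w r hr
    rw [mem_closedBall, dist_pi_le_iff hr]
    refine forall_congr' fun i => ?_
    have : dist (z i) (w i) = |E z i - E w i| ^ (a i)⁻¹ := rfl
    rw [this, Real.rpow_inv_le_iff_of_pos (abs_nonneg _) hr (ha₀ i)]
  have hvol : ∀ (w : Z) (r : ℝ), 0 ≤ r →
      μ (closedBall w r) = ∏ i, ENNReal.ofReal (2 * r ^ a i) := by
    intro w r hr
    have : closedBall w r = E ⁻¹' (Set.univ.pi fun i => closedBall (E w i) (r ^ a i)) := by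
      ext z
      simp [mem_ball z w r hr, Real.dist_eq]
    rw [this, hE.measure_preimage_equiv, volume_pi_pi]
    simp [Real.volume_closedBall]
  have : IsLocallyFiniteMeasure μ := ⟨fun w => ⟨closedBall w 1, closedBall_mem_nhds w one_pos, by
    rw [hvol w 1 zero_le_one]
    exact ENNReal.prod_lt_top fun i _ => ENNReal.ofReal_lt_top⟩⟩
  have : IsUnifLocDoublingMeasure μ := by
    refine ⟨⟨∏ i, Real.toNNReal (2 ^ a i), ?_⟩⟩
    filter_upwards [self_mem_nhdsWithin] with r hr w
    have hr : 0 < r := hr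
    rw [hvol _ _ hr.le, hvol _ _ (by positivity), ENNReal.ofNNReal_finsetProd,
      ← Finset.prod_mul_distrib]
    refine le_of_eq (Finset.prod_congr rfl fun i _ => ?_)
    rw [← ENNReal.ofReal, ← ENNReal.ofReal_mul (by positivity), Real.mul_rpow (by simp) hr.le]
    congr 1
    ring
  have key := IsUnifLocDoublingMeasure.ae_tendsto_measure_inter_div.{_, 0} μ (E ⁻¹' S) K
  have hEs : MeasurePreserving E.symm (volume.restrict S) (μ.restrict (E ⁻¹' S)) := by
    have := (hE.symm E).restrict_preimage_emb E.symm.measurableEmbedding (E ⁻¹' S)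
    rwa [← Set.preimage_comp, E.self_comp_symm, Set.preimage_id] at this
  filter_upwards [hEs.quasiMeasurePreserving.ae key] with x hx w δ hδ hxw
  have hlim := hx (fun Q => E.symm (w Q)) δ hδ (by
    filter_upwards [hxw] with Q hQ
    simpa [mem_ball _ _ _ hQ.1] using hQ.2)
  filter_upwards [hlim.eventually_ne one_ne_zero, hδ.eventually self_mem_nhdsWithin] with Q hQ hδQ
  have hne : (E ⁻¹' S ∩ closedBall (E.symm (w Q)) (δ Q)).Nonempty := by
    rw [Set.nonempty_iff_ne_empty]
    intro h
    simp [h] at hQ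
  obtain ⟨z, hzS, hz⟩ := hne
  exact ⟨E z, hzS, by simpa using (mem_ball _ _ _ (le_of_lt hδQ)).1 hz⟩

/-- Weighted Dirichlet theorem for a unipotent triangular system, with the error `ε` in the last
coordinates arbitrarily small at the expense of the error `M` in the first ones. -/
theorem exists_eventually_weighted_int_approx {d m : ℕ} (hd : 0 < d) (τ : Fin (d + m) → ℝ)
    (hτpos : ∀ i, 0 < τ i) (hτsum : ∑ i, τ i = 1) {ε : ℝ} (hε : 0 < ε) :
    ∃ M : ℝ, 1 ≤ M ∧ ∀ᶠ Q : ℕ in atTop, ∀ (x : Fin d → ℝ) (y : Fin m → ℝ)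
      (L : (Fin d → ℝ) →ₗ[ℝ] (Fin m → ℝ)),
      ∃ (q : ℕ) (p : Fin d → ℤ) (r : Fin m → ℤ), 0 < q ∧ q ≤ Q ∧
        (∀ i, |q * x i - p i| ≤ M / (Q : ℝ) ^ τ (Fin.castAdd m i)) ∧
        ∀ j, |q * y j + L (fun i => p i - q * x i) j - r j| ≤
          ε / (Q : ℝ) ^ τ (Fin.natAdd d j) := by
  let M : ℝ := max 1 (2 ^ d * (2 / ε) ^ m)
  have hM : 1 ≤ M := le_max_left _ _
  have hM₀ : 0 < M := zero_lt_one.trans_le hM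
  refine ⟨M, hM, ?_⟩
  have hlarge : ∀ (i : Fin (d + m)) (C : ℝ), ∀ᶠ Q : ℕ in atTop, C ≤ (Q : ℝ) ^ τ i := fun i C =>
    ((tendsto_rpow_atTop (hτpos i)).comp tendsto_natCast_atTop_atTop).eventually_ge_atTop C
  have hceil : ∀ t : ℝ, 1 ≤ t → (⌈t⌉₊ : ℝ) ≤ 2 * t := fun t ht => by
    linarith [Nat.ceil_lt_add_one (zero_le_one.trans ht)]
  filter_upwards [eventually_gt_atTop 0,
    eventually_all.2 fun i : Fin d => hlarge (Fin.castAdd m i) M,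
    eventually_all.2 fun j : Fin m => hlarge (Fin.natAdd d j) ε] with Q hQ hQM hQε x y L
  have hQ' : (0 : ℝ) < Q := by exact_mod_cast hQ
  have hpow : ∀ i, 0 < (Q : ℝ) ^ τ i := fun i => Real.rpow_pos_of_pos hQ' _
  have hprod : (∏ i : Fin d, ⌈(Q : ℝ) ^ τ (Fin.castAdd m i) / M⌉₊) *
      ∏ j : Fin m, ⌈(Q : ℝ) ^ τ (Fin.natAdd d j) / ε⌉₊ ≤ Q := by
    rw [← Nat.cast_le (α := ℝ)]
    push_cast
    calc (∏ i : Fin d, (⌈(Q : ℝ) ^ τ (Fin.castAdd m i) / M⌉₊ : ℝ)) *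
          ∏ j : Fin m, (⌈(Q : ℝ) ^ τ (Fin.natAdd d j) / ε⌉₊ : ℝ)
        ≤ (∏ i : Fin d, 2 * ((Q : ℝ) ^ τ (Fin.castAdd m i) / M)) *
          ∏ j : Fin m, 2 * ((Q : ℝ) ^ τ (Fin.natAdd d j) / ε) := by
          gcongr with i _ j _
          · exact hceil _ ((one_le_div hM₀).2 (hQM i))
          · exact hceil _ ((one_le_div hε).2 (hQε j))
      _ = (2 ^ d * (2 / ε) ^ m) / M ^ d * ((∏ i : Fin d, (Q : ℝ) ^ τ (Fin.castAdd m i)) *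
          ∏ j : Fin m, (Q : ℝ) ^ τ (Fin.natAdd d j)) := by
          simp only [Finset.prod_mul_distrib, Finset.prod_div_distrib, Finset.prod_const,
            Finset.card_univ, Fintype.card_fin, div_pow]
          field_simp
      _ = (2 ^ d * (2 / ε) ^ m) / M ^ d * Q := by
          rw [← Fin.prod_univ_add (fun i => (Q : ℝ) ^ τ i), ← Real.rpow_sum_of_pos hQ', hτsum,
            Real.rpow_one]
      _ ≤ 1 * Q := by
          gcongr
          rw [div_le_one (by positivity)]
          exact (le_max_right _ _).trans (le_self_pow₀ hM hd.ne')
      _ = Q := one_mul _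
  obtain ⟨q, p, r, hq, hqQ, hp, hr⟩ := exists_int_approx_of_prod_le x y L _ _
    (fun i => Nat.ceil_pos.2 (div_pos (hpow _) hM₀)) (fun j => Nat.ceil_pos.2 (div_pos (hpow _) hε))
    Q hprod
  refine ⟨q, p, r, hq, hqQ, fun i => (hp i).trans ?_, fun j => (hr j).trans ?_⟩
  · rw [← one_div_div _ M]
    exact one_div_le_one_div_of_le (div_pos (hpow _) hM₀) (Nat.le_ceil _)
  · rw [← one_div_div _ ε]
    exact one_div_le_one_div_of_le (div_pos (hpow _) hε) (Nat.le_ceil _)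

/-- Near a point `x₀` above which the graph of `f` is `c`-badly approximable there are, at every
large scale `Q`, boxes of comparable size above which the graph is not `c`-badly approximable. -/
theorem exists_box_not_bad {d m : ℕ} (hd : 0 < d) (τ : Fin (d + m) → ℝ)
    (hτpos : ∀ i, 0 < τ i) (hτsum : ∑ i, τ i = 1)
    (hτ : ∀ (i : Fin d) (j : Fin m), τ (Fin.natAdd d j) ≤ τ (Fin.castAdd m i))
    (f : (Fin d → ℝ) → Fin m → ℝ) (x₀ : Fin d → ℝ) (hf : DifferentiableAt ℝ f x₀)
    {c : ℝ} (hc : 0 < c)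
    (hbad : ∀ (p : Fin (d + m) → ℤ) (q : ℕ), 0 < q →
      ∃ i, c / (q : ℝ) ^ τ i ≤ |(q : ℝ) * Fin.append x₀ (f x₀) i - p i|) :
    ∃ s > 0, ∃ C > 0, ∀ᶠ Q : ℕ in atTop, ∃ w : Fin d → ℝ,
      (∀ i, |x₀ i - w i| ≤ C / (Q * (Q : ℝ) ^ τ (Fin.castAdd m i))) ∧
      ∀ x : Fin d → ℝ, (∀ i, |x i - w i| ≤ s / (Q * (Q : ℝ) ^ τ (Fin.castAdd m i))) →
        ∃ (p : Fin (d + m) → ℤ) (q : ℕ), 0 < q ∧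
          ∀ i, |(q : ℝ) * Fin.append x (f x) i - p i| < c / (q : ℝ) ^ τ i := by
  let L := fderiv ℝ f x₀
  let ε := c / 4
  have hε : 0 < ε := by positivity
  obtain ⟨M, hM, hdir⟩ := exists_eventually_weighted_int_approx hd τ hτpos hτsum hε
  have hM₀ : 0 < M := zero_lt_one.trans_le hM
  let M' := M + ε + ‖L‖ * M
  have hM' : 0 < M' := by positivity
  obtain ⟨κ, hκ₀, hκ⟩ : ∃ κ : ℝ, 0 < κ ∧ ∀ i, M' * κ ^ τ i < c := by
    have h : ∀ i, ∀ᶠ κ : ℝ in 𝓝[>] 0, M' * κ ^ τ i < c := fun i => by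
      have h0 : Tendsto (fun κ : ℝ => M' * κ ^ τ i) (𝓝 0) (𝓝 (M' * 0 ^ τ i)) :=
        ((Real.continuousAt_rpow_const 0 (τ i) (Or.inr (hτpos i).le)).tendsto).const_mul M'
      rw [Real.zero_rpow (hτpos i).ne', mul_zero] at h0
      exact (h0.mono_left nhdsWithin_le_nhds).eventually_lt_const hc
    obtain ⟨κ, h1, h2⟩ := ((eventually_all.2 h).and self_mem_nhdsWithin).exists
    exact ⟨κ, h2, h1⟩
  let s := c / (4 * (1 + ‖L‖))
  have hs : 0 < s := by positivity
  have hsc : s ≤ c / 4 := by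
    rw [div_le_div_iff₀ (by positivity) (by positivity)]
    nlinarith [norm_nonneg L]
  have hLs : ‖L‖ * s ≤ c / 4 := by
    simp only [s]
    rw [mul_div_assoc', div_le_div_iff₀ (by positivity) (by positivity)]
    nlinarith [norm_nonneg L]
  let C := M / κ
  have hC : 0 < C := by positivity
  let η := c / (4 * (s + C))
  have hη : 0 < η := by positivity
  obtain ⟨ρ, hρ, hlin⟩ := Metric.eventually_nhds_iff.1 (hf.hasFDerivAt.isLittleO.def hη)
  refine ⟨s, hs, C, hC, ?_⟩
  filter_upwards [hdir, eventually_gt_atTop 0,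
    tendsto_natCast_atTop_atTop.eventually_gt_atTop ((s + C) / ρ)] with Q hdir hQ hQρ
  have hQ₁ : (1 : ℝ) ≤ Q := by exact_mod_cast hQ
  have hQ₀ : (0 : ℝ) < Q := by linarith
  have hpow : ∀ i, 0 < (Q : ℝ) ^ τ i := fun i => Real.rpow_pos_of_pos hQ₀ _
  have hpowle : ∀ i j, (Q : ℝ) ^ τ (Fin.natAdd d j) ≤ (Q : ℝ) ^ τ (Fin.castAdd m i) := fun i j =>
    Real.rpow_le_rpow_of_exponent_le hQ₁ (hτ i j)
  obtain ⟨q, p, r, hq, hqQ, hp, hr⟩ := hdir x₀ (f x₀) L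
  have hq₀ : (0 : ℝ) < q := by exact_mod_cast hq
  have hqQ' : (q : ℝ) ≤ Q := by exact_mod_cast hqQ
  have hqpow : ∀ i, 0 < (q : ℝ) ^ τ i := fun i => Real.rpow_pos_of_pos hq₀ _
  have hqQpow : ∀ i, (q : ℝ) ^ τ i ≤ (Q : ℝ) ^ τ i := fun i =>
    Real.rpow_le_rpow hq₀.le hqQ' (hτpos i).le
  have hLle : ∀ (v : Fin d → ℝ) (t : ℝ) (j : Fin m), 0 ≤ t → (∀ i, |v i| ≤ t) →
      |L v j| ≤ ‖L‖ * t := fun v t j ht hv =>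
    (norm_le_pi_norm (L v) j).trans (L.le_opNorm_of_le ((pi_norm_le_iff_of_nonneg ht).2 hv))
  have hκq : κ * Q ≤ q := by
    by_contra! hlt
    have main : ∀ i, |(q : ℝ) * Fin.append x₀ (f x₀) i - (Fin.append p r i : ℤ)| ≤
        M' / (Q : ℝ) ^ τ i := by
      intro i
      induction i using Fin.addCases with
      | left i =>
        simp only [Fin.append_left]
        refine (hp i).trans (div_le_div_of_nonneg_right ?_ (hpow _).le)
        have : 0 ≤ ‖L‖ * M := by positivity
        simp only [M']
        linarith
      | right j =>
        simp only [Fin.append_right]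
        have h1 := hr j
        have h2 := hLle (fun i => p i - q * x₀ i) (M / (Q : ℝ) ^ τ (Fin.natAdd d j)) j
          (div_pos hM₀ (hpow _)).le fun i => by
            rw [abs_sub_comm]
            exact (hp i).trans (div_le_div_of_nonneg_left hM₀.le (hpow _) (hpowle i j))
        have h3 : M' / (Q : ℝ) ^ τ (Fin.natAdd d j) = M / (Q : ℝ) ^ τ (Fin.natAdd d j) +
            ε / (Q : ℝ) ^ τ (Fin.natAdd d j) + ‖L‖ * (M / (Q : ℝ) ^ τ (Fin.natAdd d j)) := by
          simp only [M']
          ring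
        have h4 : 0 < M / (Q : ℝ) ^ τ (Fin.natAdd d j) := div_pos hM₀ (hpow _)
        simp only [ContinuousLinearMap.coe_coe] at h1
        rw [h3]
        rw [abs_le] at h1 h2 ⊢
        constructor <;> linarith [h1.1, h1.2, h2.1, h2.2]
    obtain ⟨i, hi⟩ := hbad (Fin.append p r) q hq
    have h1 := hi.trans (main i)
    rw [div_le_div_iff₀ (hqpow i) (hpow i)] at h1
    have h2 : (q : ℝ) ^ τ i ≤ κ ^ τ i * (Q : ℝ) ^ τ i := by
      rw [← Real.mul_rpow hκ₀.le hQ₀.le]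
      exact Real.rpow_le_rpow hq₀.le hlt.le (hτpos i).le
    have h3 : M' * (q : ℝ) ^ τ i ≤ M' * κ ^ τ i * (Q : ℝ) ^ τ i := by
      rw [mul_assoc]
      exact mul_le_mul_of_nonneg_left h2 hM'.le
    nlinarith [mul_lt_mul_of_pos_right (hκ i) (hpow i)]
  have hx₀w : ∀ i, |x₀ i - p i / q| ≤ C / (Q * (Q : ℝ) ^ τ (Fin.castAdd m i)) := by
    intro i
    have h1 : |x₀ i - p i / q| = |q * x₀ i - p i| / q := by
      rw [← abs_of_pos hq₀, ← abs_div, abs_of_pos hq₀, sub_div, mul_div_cancel_left₀ _ hq₀.ne']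
    have h2 : C / (Q * (Q : ℝ) ^ τ (Fin.castAdd m i)) =
        M / (Q : ℝ) ^ τ (Fin.castAdd m i) / (κ * Q) := by
      have := hpow (Fin.castAdd m i)
      simp only [C]
      field_simp
    rw [h1, h2]
    exact div_le_div₀ (div_pos hM₀ (hpow _)).le (hp i) (by positivity) hκq
  refine ⟨fun i => p i / q, hx₀w, fun x hx => ⟨Fin.append p r, q, hq, ?_⟩⟩
  have hqx : ∀ i, |q * x i - p i| ≤ s / (Q : ℝ) ^ τ (Fin.castAdd m i) := by
    intro i
    have h1 : |q * x i - p i| = q * |x i - p i / q| := by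
      rw [← abs_of_pos hq₀, ← abs_mul, abs_of_pos hq₀, mul_sub, mul_div_cancel₀ _ hq₀.ne']
    have h2 : s / (Q : ℝ) ^ τ (Fin.castAdd m i) =
        Q * (s / (Q * (Q : ℝ) ^ τ (Fin.castAdd m i))) := by
      have := hpow (Fin.castAdd m i)
      field_simp
    rw [h1, h2]
    exact mul_le_mul hqQ' (hx i) (abs_nonneg _) hQ₀.le
  have hxx₀ : ∀ i, |x i - x₀ i| ≤ (s + C) / (Q * (Q : ℝ) ^ τ (Fin.castAdd m i)) := by
    intro i
    rw [add_div]
    refine (abs_sub_le _ (p i / q : ℝ) _).trans (add_le_add (hx i) ?_)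
    rw [abs_sub_comm]
    exact hx₀w i
  have hnear : dist x x₀ < ρ := by
    have : dist x x₀ ≤ (s + C) / Q := by
      rw [dist_pi_le_iff (by positivity)]
      refine fun i => (hxx₀ i).trans (div_le_div_of_nonneg_left (by positivity) hQ₀ ?_)
      exact le_mul_of_one_le_right hQ₀.le (Real.one_le_rpow hQ₁ (hτpos _).le)
    exact this.trans_lt ((div_lt_comm₀ hρ hQ₀).1 hQρ)
  intro i
  induction i using Fin.addCases with
  | left i =>
    simp only [Fin.append_left]
    calc _ ≤ s / (Q : ℝ) ^ τ (Fin.castAdd m i) := hqx i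
      _ ≤ s / (q : ℝ) ^ τ (Fin.castAdd m i) :=
          div_le_div_of_nonneg_left hs.le (hqpow _) (hqQpow _)
      _ < _ := div_lt_div_of_pos_right (by linarith) (hqpow _)
  | right j =>
    simp only [Fin.append_right]
    have h1 := hr j
    simp only [ContinuousLinearMap.coe_coe] at h1
    have h2 := hLle (fun i => q * x i - p i) (s / (Q : ℝ) ^ τ (Fin.natAdd d j)) j
      (div_pos hs (hpow _)).le fun i =>
        (hqx i).trans (div_le_div_of_nonneg_left hs.le (hpow _) (hpowle i j))
    have h3 : |q * (f x j - f x₀ j - L (x - x₀) j)| ≤ c / 4 / (Q : ℝ) ^ τ (Fin.natAdd d j) := by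
      have hn : ‖x - x₀‖ ≤ (s + C) / (Q * (Q : ℝ) ^ τ (Fin.natAdd d j)) := by
        have := hpow (Fin.natAdd d j)
        rw [pi_norm_le_iff_of_nonneg (by positivity)]
        refine fun i => (hxx₀ i).trans (div_le_div_of_nonneg_left (by positivity) (by positivity) ?_)
        exact mul_le_mul_of_nonneg_left (hpowle i j) hQ₀.le
      have he : |f x j - f x₀ j - L (x - x₀) j| ≤ η * ‖x - x₀‖ :=
        (norm_le_pi_norm (f x - f x₀ - L (x - x₀)) j).trans (hlin hnear)
      rw [abs_mul, abs_of_pos hq₀]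
      calc (q : ℝ) * |f x j - f x₀ j - L (x - x₀) j|
          ≤ Q * (η * ((s + C) / (Q * (Q : ℝ) ^ τ (Fin.natAdd d j)))) :=
            mul_le_mul hqQ' (he.trans (mul_le_mul_of_nonneg_left hn hη.le)) (abs_nonneg _) hQ₀.le
        _ = c / 4 / (Q : ℝ) ^ τ (Fin.natAdd d j) := by
            have := hpow (Fin.natAdd d j)
            have : 0 < s + C := by positivity
            simp only [η]
            field_simp
    have hsplit : (q : ℝ) * L (x - x₀) j =
        L (fun i => p i - q * x₀ i) j + L (fun i => q * x i - p i) j := by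
      rw [← Pi.add_apply, ← map_add, ← smul_eq_mul, ← Pi.smul_apply, ← map_smul]
      refine congrArg (fun v => L v j) (funext fun i => ?_)
      simp only [Pi.add_apply, Pi.smul_apply, Pi.sub_apply, smul_eq_mul]
      ring
    have h4 : ‖L‖ * (s / (Q : ℝ) ^ τ (Fin.natAdd d j)) ≤ c / 4 / (Q : ℝ) ^ τ (Fin.natAdd d j) := by
      rw [mul_div_assoc']
      exact div_le_div_of_nonneg_right hLs (hpow _).le
    calc _ ≤ 3 * (c / 4 / (Q : ℝ) ^ τ (Fin.natAdd d j)) := by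
          rw [mul_sub, hsplit] at h3
          rw [abs_le] at h1 h2 h3 ⊢
          simp only [ε] at h1
          constructor <;> linarith [h1.1, h1.2, h2.1, h2.2, h3.1, h3.2]
      _ < c / (Q : ℝ) ^ τ (Fin.natAdd d j) := by
          have : 0 < c / (Q : ℝ) ^ τ (Fin.natAdd d j) := div_pos hc (hpow _)
          rw [div_right_comm]
          linarith
      _ ≤ _ := div_le_div_of_nonneg_left hc.le (hqpow _) (hqQpow _)

/-- Theorem (Bad on real manifolds): let `f : U → ℝ^m` be a `C²` map on an open set
`U ⊆ ℝ^d`, `F(x) = (x, f(x))`, and let `τ ∈ ℝ^n_{>0}` (`n = d + m`) satisfy `∑ τ_i = 1`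
and `min_{i ≤ d} τ_i ≥ max_{j ≤ m} τ_{d+j}`.  Then the set of parameters `x ∈ U` with
`F(x)` `τ`-badly approximable has `d`-dimensional Lebesgue measure zero. -/
theorem bad_real_manifold_measure_zero (d m : ℕ) (hd : 0 < d)
    (U : Set (Fin d → ℝ)) (hU : IsOpen U)
    (f : (Fin d → ℝ) → Fin m → ℝ) (hf : ContDiffOn ℝ 2 f U)
    (τ : Fin (d + m) → ℝ) (hτpos : ∀ i, 0 < τ i) (hτsum : ∑ i, τ i = 1)
    (hτ : ∀ (i : Fin d) (j : Fin m), τ (Fin.natAdd d j) ≤ τ (Fin.castAdd m i)) :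
    volume {x ∈ U | Fin.append x (f x) ∈ BadReal (d + m) τ} = 0 := by
  let S : ℕ → Set (Fin d → ℝ) := fun k => {x ∈ U | ∀ (p : Fin (d + m) → ℤ) (q : ℕ), 0 < q →
    ∃ i, 1 / ((k : ℝ) + 1) / (q : ℝ) ^ τ i ≤ |(q : ℝ) * Fin.append x (f x) i - p i|}
  have hsub : {x ∈ U | Fin.append x (f x) ∈ BadReal (d + m) τ} ⊆ ⋃ k, S k := by
    rintro x ⟨hxU, c, hc, hx⟩
    obtain ⟨k, hk⟩ := exists_nat_one_div_lt hc
    refine Set.mem_iUnion.2 ⟨k, hxU, fun p q hq => ?_⟩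
    obtain ⟨i, hi⟩ := hx p q hq
    exact ⟨i, (by gcongr : _ ≤ c / (q : ℝ) ^ τ i).trans hi⟩
  refine measure_mono_null hsub (measure_iUnion_null fun k => ?_)
  have hk : (0 : ℝ) < 1 / ((k : ℝ) + 1) := by positivity
  let a : Fin d → ℝ := fun i => 1 + τ (Fin.castAdd m i)
  have ha : ∀ i, 1 ≤ a i := fun i => le_add_of_nonneg_right (hτpos _).le
  rw [← Measure.restrict_apply_self]
  have hae := ae_all_iff.2 fun K : ℕ => ae_restrict_eventually_box_inter_nonempty a ha (S k) K
  refine measure_mono_null ?_ (ae_iff.1 hae)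
  intro x₀ hx₀ hdens
  have hfx₀ : DifferentiableAt ℝ f x₀ :=
    (hf.contDiffAt (hU.mem_nhds hx₀.1)).differentiableAt two_ne_zero
  obtain ⟨s, hs, C, hC, hbox⟩ := exists_box_not_bad hd τ hτpos hτsum hτ f x₀ hfx₀ hk hx₀.2
  obtain ⟨N, hN⟩ := eventually_atTop.1 hbox
  choose w hwx₀ hw using fun Q : ℕ => hN (max Q N) (le_max_right _ _)
  let t := min 1 s
  have ht : 0 < t := lt_min one_pos hs
  obtain ⟨K, hK⟩ := exists_nat_ge (max 1 C / t)
  rw [div_le_iff₀ ht] at hK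
  have hKC : C ≤ K * t := (le_max_right _ _).trans hK
  have hK₁ : 1 ≤ K * t := (le_max_left _ _).trans hK
  have hQa : ∀ {Q : ℕ}, 0 < Q → ∀ i,
      (Q : ℝ) * (Q : ℝ) ^ τ (Fin.castAdd m i) = (Q : ℝ) ^ a i := fun {Q} hQ i => by
    rw [Real.rpow_add (by exact_mod_cast hQ), Real.rpow_one]
  have hδ : Tendsto (fun Q : ℕ => t / Q) atTop (𝓝[>] 0) := by
    refine tendsto_nhdsWithin_iff.2 ⟨tendsto_const_div_atTop_nhds_zero_nat t, ?_⟩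
    filter_upwards [eventually_gt_atTop 0] with Q hQ
    exact div_pos ht (by exact_mod_cast hQ)
  have hmeet := hdens K w (fun Q => t / Q) hδ (by
    filter_upwards [eventually_gt_atTop 0, eventually_ge_atTop N] with Q hQ hQN
    refine ⟨by positivity, fun i => ?_⟩
    have h := hwx₀ Q i
    rw [max_eq_left hQN, hQa hQ] at h
    refine h.trans ?_
    rw [mul_div_assoc', Real.div_rpow (by positivity) (by positivity)]
    gcongr
    exact hKC.trans (Real.self_le_rpow_of_one_le hK₁ (ha i)))
  obtain ⟨Q, ⟨y, hy, hyw⟩, hQ, hQN⟩ :=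
    (hmeet.and ((eventually_gt_atTop 0).and (eventually_ge_atTop N))).exists
  obtain ⟨p, q, hq, hpq⟩ := hw Q y fun i => by
    refine (hyw i).trans ?_
    rw [max_eq_left hQN, hQa hQ, Real.div_rpow ht.le (by positivity)]
    gcongr
    exact (Real.rpow_le_self_of_le_one ht.le (min_le_left _ _) (ha i)).trans (min_le_right _ _)
  obtain ⟨i, hi⟩ := hy.2 p q hq
  exact (hpq i).not_ge hi
end
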